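/- arXiv:2509.17558 — 2 statements merged into one kernel-verified Lean document; each statement's English description precedes it below -/
import Mathlib

section
/- Let W^H be a fractional Brownian motion with Hurst index H ∈ (0,1), h > 0, and let X^h be the associated nifBm. Then for every t ≥ 0 and every integer n ≥ 0, E[(X_{t+h}^h − X_t^h)(X_{t+(n+1)h}^h − X_{t+nh}^h)] = h^{2H}·γ(H,n). In particular this covariance does not depend on t. -/
open MeasureTheory ProbabilityTheory Filter Real Matrix Topology

noncomputable section

variable {Ω : Type*} [MeasurableSpace Ω]

/-- A (centered) fractional Brownian motion with Hurst index `H` on the probability space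
`(Ω, P)`: a jointly measurable process with a.s. continuous sample paths, whose
finite-dimensional distributions are centered Gaussian (equivalently, every finite linear
combination of values of the process is a centered real Gaussian random variable), with
covariance `E[W_s W_t] = (s^{2H} + t^{2H} - |s-t|^{2H})/2` for `s, t ≥ 0`. -/
structure IsFBM (P : Measure Ω) (H : ℝ) (W : ℝ → Ω → ℝ) : Prop where
  jointMeasurable : Measurable (Function.uncurry W)
  gaussian_fdd : ∀ (n : ℕ) (t : Fin n → ℝ), (∀ i, 0 ≤ t i) → ∀ c : Fin n → ℝ,
    ∃ v : NNReal, P.map (fun ω => ∑ i, c i * W (t i) ω) = gaussianReal 0 v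
  cov : ∀ s t : ℝ, 0 ≤ s → 0 ≤ t →
    ∫ ω, W s ω * W t ω ∂P = (s ^ (2*H) + t ^ (2*H) - |s - t| ^ (2*H)) / 2
  cont : ∀ᵐ ω ∂P, Continuous fun t => W t ω

/-- The normalized integrated fractional Brownian motion (nifBm) with window `h`:
`X_t^{h,H} = (1/h) ∫_t^{t+h} W_u du`. -/
def nifBm (W : ℝ → Ω → ℝ) (h t : ℝ) (ω : Ω) : ℝ := (1/h) * ∫ u in t..(t+h), W u ω

/-- The function `γ(H, n)`. -/
def gam (H : ℝ) (n : ℤ) : ℝ :=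
  (|(n:ℝ) - 2| ^ (2*H+2) - 4 * |(n:ℝ) - 1| ^ (2*H+2) + 6 * |(n:ℝ)| ^ (2*H+2)
    - 4 * |(n:ℝ) + 1| ^ (2*H+2) + |(n:ℝ) + 2| ^ (2*H+2)) / (4 * (2*H+1) * (H+1))

/-- `log₊ x = log x` for `x > 0` and `0` otherwise. -/
def logpos (x : ℝ) : ℝ := if 0 < x then Real.log x else 0

theorem IsFBM.memLp_two {P : Measure Ω} {H : ℝ} {W : ℝ → Ω → ℝ} (hW : IsFBM P H W) {s : ℝ}
    (hs : 0 ≤ s) : MemLp (W s) 2 P := by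
  obtain ⟨v, hv⟩ := hW.gaussian_fdd 1 (fun _ => s) (fun _ => hs) (fun _ => 1)
  simp only [Finset.univ_unique, one_mul, Finset.sum_const, Finset.card_singleton,
    one_smul] at hv
  have hm : Measurable (W s) := hW.jointMeasurable.of_uncurry_left
  have h2 : MemLp id 2 (P.map (W s)) := by
    rw [hv]
    exact memLp_id_gaussianReal 2
  exact (memLp_map_measure_iff h2.1 hm.aemeasurable).1 h2

theorem IsFBM.integral_norm_mul_le {P : Measure Ω} {H : ℝ} {W : ℝ → Ω → ℝ}
    (hW : IsFBM P H W) (hH : 0 < H) {s t : ℝ} (hs : 0 ≤ s) (ht : 0 ≤ t) :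
    ∫ ω, ‖W s ω * W t ω‖ ∂P ≤ (s ^ (2 * H) + t ^ (2 * H)) / 2 := by
  have second_moment : ∀ r : ℝ, 0 ≤ r → ∫ ω, W r ω * W r ω ∂P = r ^ (2 * H) := fun r hr => by
    rw [hW.cov r r hr hr, sub_self, abs_zero, Real.zero_rpow (by positivity)]
    ring
  have hint : ∀ r : ℝ, 0 ≤ r → Integrable (fun ω => W r ω * W r ω) P := fun r hr =>
    (hW.memLp_two hr).integrable_mul (hW.memLp_two hr)
  rw [← second_moment s hs, ← second_moment t ht, ← integral_add (hint s hs) (hint t ht),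
    ← integral_div]
  refine integral_mono ((hW.memLp_two hs).integrable_mul (hW.memLp_two ht)).norm
    (((hint s hs).add (hint t ht)).div_const 2) fun ω => ?_
  simp only [Real.norm_eq_abs, abs_mul]
  nlinarith [sq_nonneg (|W s ω| - |W t ω|), abs_mul_abs_self (W s ω), abs_mul_abs_self (W t ω)]

theorem IsFBM.integrable_mul_prod {P : Measure Ω} [IsProbabilityMeasure P] {H : ℝ}
    {W : ℝ → Ω → ℝ} (hW : IsFBM P H W) (hH : 0 < H) {a b c d : ℝ} (ha : 0 ≤ a) (hc : 0 ≤ c) :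
    Integrable (fun p : Ω × (ℝ × ℝ) => W p.2.1 p.1 * W p.2.2 p.1)
      (P.prod ((volume.restrict (Set.Ioc a b)).prod (volume.restrict (Set.Ioc c d)))) := by
  have hmeas : Measurable (fun p : Ω × (ℝ × ℝ) => W p.2.1 p.1 * W p.2.2 p.1) :=
    (hW.jointMeasurable.comp (measurable_snd.fst.prodMk measurable_fst)).mul
      (hW.jointMeasurable.comp (measurable_snd.snd.prodMk measurable_fst))
  have hmem : ∀ᵐ p : ℝ × ℝ ∂((volume.restrict (Set.Ioc a b)).prod
      (volume.restrict (Set.Ioc c d))), p ∈ Set.Ioc a b ×ˢ Set.Ioc c d := by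
    rw [Measure.prod_restrict]
    exact ae_restrict_mem (measurableSet_Ioc.prod measurableSet_Ioc)
  rw [integrable_prod_iff' hmeas.aestronglyMeasurable]
  constructor
  · filter_upwards [hmem] with p hp
    exact (hW.memLp_two (ha.trans hp.1.1.le)).integrable_mul
      (hW.memLp_two (hc.trans hp.2.1.le))
  · refine Integrable.of_bound
      (hmeas.norm.stronglyMeasurable.integral_prod_left' (μ := P)).aestronglyMeasurable
      ((b ^ (2 * H) + d ^ (2 * H)) / 2) ?_
    filter_upwards [hmem] with p hp
    have h1 : 0 ≤ p.1 := ha.trans hp.1.1.le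
    have h2 : 0 ≤ p.2 := hc.trans hp.2.1.le
    rw [Real.norm_of_nonneg (integral_nonneg fun _ => norm_nonneg _)]
    refine (hW.integral_norm_mul_le hH h1 h2).trans ?_
    have := hp.1.2
    have := hp.2.2
    gcongr

theorem IsFBM.integrable_intervalIntegral_mul {P : Measure Ω} [IsProbabilityMeasure P] {H : ℝ}
    {W : ℝ → Ω → ℝ} (hW : IsFBM P H W) (hH : 0 < H) {a b c d : ℝ} (ha : 0 ≤ a) (hc : 0 ≤ c)
    (hab : a ≤ b) (hcd : c ≤ d) :
    Integrable (fun ω => (∫ u in a..b, W u ω) * ∫ v in c..d, W v ω) P := by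
  simp_rw [intervalIntegral.integral_of_le hab, intervalIntegral.integral_of_le hcd,
    ← integral_prod_mul (fun u => W u _) (fun v => W v _)]
  exact (hW.integrable_mul_prod hH ha hc).integral_prod_left

theorem IsFBM.integral_intervalIntegral_mul {P : Measure Ω} [IsProbabilityMeasure P] {H : ℝ}
    {W : ℝ → Ω → ℝ} (hW : IsFBM P H W) (hH : 0 < H) {a b c d : ℝ} (ha : 0 ≤ a) (hc : 0 ≤ c)
    (hab : a ≤ b) (hcd : c ≤ d) :
    ∫ ω, (∫ u in a..b, W u ω) * (∫ v in c..d, W v ω) ∂P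
      = ∫ u in a..b, ∫ v in c..d, (u ^ (2 * H) + v ^ (2 * H) - |u - v| ^ (2 * H)) / 2 := by
  have hint := hW.integrable_mul_prod (b := b) (d := d) hH ha hc
  simp_rw [intervalIntegral.integral_of_le hab, intervalIntegral.integral_of_le hcd,
    ← integral_prod_mul (fun u => W u _) (fun v => W v _)]
  rw [integral_integral_swap hint, integral_prod _ hint.integral_prod_right]
  refine setIntegral_congr_fun measurableSet_Ioc fun u hu =>
    setIntegral_congr_fun measurableSet_Ioc fun v hv => ?_
  exact hW.cov u v (ha.trans hu.1.le) (hc.trans hv.1.le)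

theorem hasDerivAt_mul_abs_rpow {q : ℝ} (hq : 0 < q) (x : ℝ) :
    HasDerivAt (fun y : ℝ => y * |y| ^ q) ((q + 1) * |x| ^ q) x := by
  have hcont : Continuous fun y : ℝ => |y| ^ q := continuous_abs.rpow_const fun _ => Or.inr hq.le
  have hne : ∀ y : ℝ, y ≠ 0 →
      HasDerivAt (fun y : ℝ => y * |y| ^ q) ((q + 1) * |y| ^ q) y := fun y hy => by
    refine ((hasDerivAt_id y).mul
      ((hasDerivAt_abs hy).rpow_const (p := q) (Or.inl (abs_ne_zero.2 hy)))).congr_deriv ?_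
    rw [Real.rpow_sub_one (abs_ne_zero.2 hy)]
    have := abs_ne_zero.2 hy
    have hs : y * (SignType.sign y : ℝ) = |y| := self_mul_sign y
    simp only [id]
    field_simp
    linear_combination q * hs
  rcases eq_or_ne x 0 with rfl | hx
  · exact hasDerivAt_of_hasDerivAt_of_ne hne (continuous_id.mul hcont).continuousAt
      (continuous_const.mul hcont).continuousAt
  · exact hne x hx

theorem integral_integral_abs_sub_rpow {q : ℝ} (hq : 0 < q) (a b c d : ℝ) :
    ∫ u in a..b, ∫ v in c..d, |u - v| ^ q
      = (|b - c| ^ (q + 2) - |a - c| ^ (q + 2) - |b - d| ^ (q + 2) + |a - d| ^ (q + 2))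
        / ((q + 1) * (q + 2)) := by
  have hcont : Continuous fun y : ℝ => |y| ^ q := continuous_abs.rpow_const fun _ => Or.inr hq.le
  have hinner : ∀ u, ∫ v in c..d, |u - v| ^ q
      = ((u - c) * |u - c| ^ q - (u - d) * |u - d| ^ q) / (q + 1) := fun u => by
    rw [intervalIntegral.integral_comp_sub_left (fun y => |y| ^ q) u,
      intervalIntegral.integral_eq_sub_of_hasDerivAt
        (f := fun y => y * |y| ^ q / (q + 1)) _ (hcont.intervalIntegrable _ _)]
    · ring
    · intro y _
      refine ((hasDerivAt_mul_abs_rpow hq y).div_const (q + 1)).congr_deriv ?_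
      field_simp
  have hprim : ∀ e u : ℝ, HasDerivAt (fun y => |y - e| ^ (q + 2) / (q + 2))
      ((u - e) * |u - e| ^ q) u := fun e u => by
    refine (((hasDerivAt_abs_rpow (u - e) (by linarith : 1 < q + 2)).comp_sub_const u e).div_const
      (q + 2)).congr_deriv ?_
    rw [add_sub_cancel_right]
    field_simp
  have hcont' : ∀ e : ℝ, Continuous fun u : ℝ => (u - e) * |u - e| ^ q := fun e =>
    (continuous_id.mul hcont).comp (continuous_id.sub continuous_const)
  simp_rw [hinner]
  rw [intervalIntegral.integral_eq_sub_of_hasDerivAt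
    (fun u _ => ((hprim c u).sub (hprim d u)).div_const (q + 1))
    ((((hcont' c).sub (hcont' d)).div_const _).intervalIntegrable _ _)]
  simp only [Pi.sub_apply]
  field_simp
  ring

theorem IsFBM.integral_intervalIntegral_mul_eq {P : Measure Ω} [IsProbabilityMeasure P] {H : ℝ}
    {W : ℝ → Ω → ℝ} (hW : IsFBM P H W) (hH : 0 < H) {a b c d : ℝ} (ha : 0 ≤ a) (hc : 0 ≤ c)
    (hab : a ≤ b) (hcd : c ≤ d) :
    ∫ ω, (∫ u in a..b, W u ω) * (∫ v in c..d, W v ω) ∂P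
      = ((d - c) * (∫ u in a..b, u ^ (2 * H)) + (b - a) * (∫ v in c..d, v ^ (2 * H))
        - (|b - c| ^ (2 * H + 2) - |a - c| ^ (2 * H + 2) - |b - d| ^ (2 * H + 2)
          + |a - d| ^ (2 * H + 2)) / ((2 * H + 1) * (2 * H + 2))) / 2 := by
  have hq : 0 < 2 * H := by positivity
  have hpow : Continuous fun y : ℝ => y ^ (2 * H) := Real.continuous_rpow_const hq.le
  have habs : Continuous fun p : ℝ × ℝ => |p.1 - p.2| ^ (2 * H) :=
    (continuous_fst.sub continuous_snd).abs.rpow_const fun _ => Or.inr hq.le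
  have hinner : ∀ u, ∫ v in c..d, (u ^ (2 * H) + v ^ (2 * H) - |u - v| ^ (2 * H)) / 2
      = ((d - c) * u ^ (2 * H) + (∫ v in c..d, v ^ (2 * H))
        - ∫ v in c..d, |u - v| ^ (2 * H)) / 2 := fun u => by
    rw [intervalIntegral.integral_div, intervalIntegral.integral_sub,
      intervalIntegral.integral_add, intervalIntegral.integral_const, smul_eq_mul]
    · exact continuous_const.intervalIntegrable _ _
    · exact hpow.intervalIntegrable _ _
    · exact (continuous_const.add hpow).intervalIntegrable _ _
    · exact (habs.comp (Continuous.prodMk_right u)).intervalIntegrable _ _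
  rw [hW.integral_intervalIntegral_mul hH ha hc hab hcd]
  simp_rw [hinner]
  rw [intervalIntegral.integral_div, intervalIntegral.integral_sub,
    intervalIntegral.integral_add, intervalIntegral.integral_const,
    intervalIntegral.integral_const_mul, smul_eq_mul, integral_integral_abs_sub_rpow hq]
  · exact (continuous_const.mul hpow).intervalIntegrable _ _
  · exact continuous_const.intervalIntegrable _ _
  · exact ((continuous_const.mul hpow).add continuous_const).intervalIntegrable _ _
  · exact (intervalIntegral.continuous_parametric_intervalIntegral_of_continuous' habs
      c d).intervalIntegrable _ _

/-- Incremental covariance of the nifBm: for all `t ≥ 0` and `n ∈ ℕ`,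
`E[(X_{t+h}^h - X_t^h)(X_{t+(n+1)h}^h - X_{t+nh}^h)] = h^{2H} γ(H,n)`;
in particular it does not depend on `t`. -/
theorem nifBm_incremental_covariance
    (P : Measure Ω) [IsProbabilityMeasure P] (H : ℝ) (hH : H ∈ Set.Ioo (0:ℝ) 1)
    (W : ℝ → Ω → ℝ) (hW : IsFBM P H W) (h : ℝ) (hh : 0 < h)
    (t : ℝ) (ht : 0 ≤ t) (n : ℕ) :
    ∫ ω, (nifBm W h (t+h) ω - nifBm W h t ω)
        * (nifBm W h (t+(n+1)*h) ω - nifBm W h (t+n*h) ω) ∂P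
      = h ^ (2*H) * gam H n := by
  have hH0 : 0 < H := hH.1
  have hn : (0 : ℝ) ≤ n * h := by positivity
  set Y : ℝ → Ω → ℝ := fun a ω => ∫ u in a..(a + h), W u ω with hY
  have hint : ∀ a c : ℝ, 0 ≤ a → 0 ≤ c → Integrable (fun ω => Y a ω * Y c ω) P :=
    fun a c ha hc => hW.integrable_intervalIntegral_mul hH0 ha hc (by linarith) (by linarith)
  have hcov : ∀ a c : ℝ, 0 ≤ a → 0 ≤ c → ∫ ω, Y a ω * Y c ω ∂P = _ :=
    fun a c ha hc => hW.integral_intervalIntegral_mul_eq hH0 ha hc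
      (by linarith : a ≤ a + h) (by linarith : c ≤ c + h)
  have hth : 0 ≤ t + h := by linarith
  have htn : 0 ≤ t + n * h := by linarith
  have htn1 : 0 ≤ t + (n + 1) * h := by linarith
  have hexpand : ∀ ω, (nifBm W h (t+h) ω - nifBm W h t ω)
      * (nifBm W h (t+(n+1)*h) ω - nifBm W h (t+n*h) ω)
      = (1 / h ^ 2) * (Y (t+h) ω * Y (t+(n+1)*h) ω - Y (t+h) ω * Y (t+n*h) ω
        - (Y t ω * Y (t+(n+1)*h) ω - Y t ω * Y (t+n*h) ω)) := fun ω => by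
    simp only [nifBm, hY]
    ring
  have hdiff : ∀ a : ℝ, 0 ≤ a →
      Integrable (fun ω => Y a ω * Y (t+(n+1)*h) ω - Y a ω * Y (t+n*h) ω) P :=
    fun a ha => (hint _ _ ha htn1).sub (hint _ _ ha htn)
  simp_rw [hexpand]
  rw [integral_const_mul, integral_sub (hdiff _ hth) (hdiff _ ht), integral_sub (hint _ _ hth htn1)
    (hint _ _ hth htn), integral_sub (hint _ _ ht htn1) (hint _ _ ht htn),
    hcov _ _ hth htn1, hcov _ _ hth htn, hcov _ _ ht htn1, hcov _ _ ht htn]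
  have hscale : ∀ x k : ℝ, x = -(k * h) →
      |x| ^ (2 * H + 2) = h ^ (2 * H) * h ^ 2 * |k| ^ (2 * H + 2) := fun x k hx => by
    rw [hx, abs_neg, abs_mul, abs_of_pos hh, Real.mul_rpow (abs_nonneg k) hh.le,
      Real.rpow_add hh, Real.rpow_two]
    ring
  rw [hscale (t + h + h - (t + (n + 1) * h)) (n - 1) (by ring),
    hscale (t + h - (t + (n + 1) * h)) n (by ring),
    hscale (t + h + h - (t + (n + 1) * h + h)) n (by ring),
    hscale (t + h - (t + (n + 1) * h + h)) (n + 1) (by ring),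
    hscale (t + h + h - (t + n * h)) (n - 2) (by ring),
    hscale (t + h - (t + n * h)) (n - 1) (by ring),
    hscale (t + h + h - (t + n * h + h)) (n - 1) (by ring),
    hscale (t + h - (t + n * h + h)) n (by ring),
    hscale (t - (t + (n + 1) * h)) (n + 1) (by ring),
    hscale (t - (t + (n + 1) * h + h)) (n + 2) (by ring),
    hscale (t - (t + n * h)) n (by ring),
    hscale (t - (t + n * h + h)) (n + 1) (by ring), gam, Int.cast_natCast]
  have h1 : 2 * H + 1 ≠ 0 := by positivity
  have h2 : H + 1 ≠ 0 := by positivity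
  rw [show 2 * H + 2 = 2 * (H + 1) by ring]
  field_simp
  ring
end
end

section
/- Let W^H be a fractional Brownian motion with Hurst index H ∈ (0,1). For every h > 0 and c > 0, the nifBm is self-similar with index H in the following sense: the processes {X_{ct}^{ch,H}, t ≥ 0} and {c^H X_t^{h,H}, t ≥ 0} have the same finite-dimensional distributions, i.e., for every n ∈ ℕ and all t₁, …, t_n ≥ 0, the law of the random vector (X_{ct₁}^{ch,H}, …, X_{ct_n}^{ch,H}) on ℝⁿ equals the law of (c^H X_{t₁}^{h,H}, …, c^H X_{t_n}^{h,H}). -/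
open MeasureTheory ProbabilityTheory Filter Real Matrix Topology

noncomputable section

variable {Ω : Type*} [MeasurableSpace Ω]

/-- Left-endpoint Riemann sums of a continuous function on `[0, 1]` converge to its integral. -/
lemma tendsto_sum_mul_of_continuous {g : ℝ → ℝ} (hg : Continuous g) :
    Tendsto (fun N : ℕ => ∑ k : Fin N, (N : ℝ)⁻¹ * g (k / N)) atTop (𝓝 (∫ x in (0:ℝ)..1, g x)) := by
  have huc := isCompact_Icc.uniformContinuousOn_of_continuous
    (hg.continuousOn (s := Set.Icc (0:ℝ) 1))
  rw [Metric.uniformContinuousOn_iff] at huc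
  rw [Metric.tendsto_atTop]
  intro ε hε
  obtain ⟨δ, hδ, hgδ⟩ := huc (ε / 2) (half_pos hε)
  obtain ⟨N₀, hN₀⟩ := exists_nat_gt (1 / δ)
  refine ⟨N₀ + 1, fun N hN => ?_⟩
  have hNpos : (0:ℝ) < N := by exact_mod_cast (by omega : 0 < N)
  have hNδ : (N : ℝ)⁻¹ < δ := by
    rw [inv_lt_comm₀ hNpos hδ, ← one_div]
    exact hN₀.trans_le (by exact_mod_cast (by omega : N₀ ≤ N))
  have hsplit : ∫ x in (0:ℝ)..1, g x
      = ∑ k : Fin N, ∫ x in ((k : ℕ) / N : ℝ)..((k + 1 : ℕ) / N : ℝ), g x := by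
    rw [Fin.sum_univ_eq_sum_range
      (fun k => ∫ x in ((k : ℕ) / N : ℝ)..((k + 1 : ℕ) / N : ℝ), g x) N,
      intervalIntegral.sum_integral_adjacent_intervals (a := fun k : ℕ => (k / N : ℝ))
        fun k _ => hg.intervalIntegrable _ _]
    simp [hNpos.ne']
  have hterm : ∀ k : Fin N,
      ‖(N : ℝ)⁻¹ * g (k / N) - ∫ x in ((k : ℕ) / N : ℝ)..((k + 1 : ℕ) / N : ℝ), g x‖
        ≤ ε / 2 * (N : ℝ)⁻¹ := by
    intro k
    have hlen : ((k + 1 : ℕ) / N : ℝ) - (k : ℕ) / N = (N : ℝ)⁻¹ := by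
      push_cast
      field_simp
      ring
    have hle : ((k : ℕ) / N : ℝ) ≤ ((k + 1 : ℕ) / N : ℝ) := by
      have := inv_pos.2 hNpos
      linarith
    have hlast : ((k + 1 : ℕ) / N : ℝ) ≤ 1 := by
      rw [div_le_one hNpos]
      exact_mod_cast k.2
    have hfirst : (0:ℝ) ≤ (k : ℕ) / N := by positivity
    have hconst : (N : ℝ)⁻¹ * g (k / N)
        = ∫ _x in ((k : ℕ) / N : ℝ)..((k + 1 : ℕ) / N : ℝ), g (k / N) := by
      rw [intervalIntegral.integral_const, hlen, smul_eq_mul]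
    rw [hconst, ← intervalIntegral.integral_sub intervalIntegrable_const
      (hg.intervalIntegrable _ _)]
    refine (intervalIntegral.norm_integral_le_of_norm_le_const (C := ε / 2)
      fun x hx => ?_).trans_eq ?_
    · rw [Set.uIoc_of_le hle] at hx
      rw [← dist_eq_norm]
      refine (hgδ _ ⟨hfirst, hle.trans hlast⟩ _ ⟨hfirst.trans hx.1.le, hx.2.trans hlast⟩ ?_).le
      rw [dist_comm, Real.dist_eq, abs_of_nonneg (sub_nonneg.2 hx.1.le)]
      linarith [hx.2]
    · rw [hlen, abs_of_pos (inv_pos.2 hNpos)]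
  rw [hsplit, dist_eq_norm, ← Finset.sum_sub_distrib]
  calc _ ≤ ∑ _k : Fin N, ε / 2 * (N : ℝ)⁻¹ := norm_sum_le_of_le _ fun k _ => hterm k
    _ = ε / 2 := by
      rw [Finset.sum_const, Finset.card_univ, Fintype.card_fin, nsmul_eq_mul]
      field_simp
    _ < ε := half_lt_self hε

lemma nifBm_eq_integral_unit {α : Type*} (W : ℝ → α → ℝ) {h : ℝ} (hh : h ≠ 0) (t : ℝ)
    (ω : α) :
    nifBm W h t ω = ∫ x in (0:ℝ)..1, W (t + h * x) ω := by
  rw [intervalIntegral.integral_comp_add_mul (fun u => W u ω) hh]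
  simp [nifBm]

/-- The `N`-th left-endpoint Riemann sum of `nifBm W h t`. -/
def nifBmSum (W : ℝ → Ω → ℝ) (h t : ℝ) (N : ℕ) (ω : Ω) : ℝ :=
  ∑ k : Fin N, (N : ℝ)⁻¹ * W (t + h * (k / N)) ω

lemma tendsto_nifBmSum {α : Type*} {W : ℝ → α → ℝ} {ω : α}
    (hω : Continuous fun t => W t ω) {h : ℝ} (hh : h ≠ 0) (t : ℝ) :
    Tendsto (fun N => nifBmSum W h t N ω) atTop (𝓝 (nifBm W h t ω)) := by
  rw [nifBm_eq_integral_unit W hh]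
  exact tendsto_sum_mul_of_continuous (g := fun x => W (t + h * x) ω) (by fun_prop)

lemma memLp_two_of_map_eq_gaussianReal {P : Measure Ω} {Y : Ω → ℝ} (hY : Measurable Y) {v : NNReal}
    (h : P.map Y = gaussianReal 0 v) : MemLp Y 2 P := by
  have h2 : MemLp id 2 (P.map Y) := by
    rw [h]
    exact memLp_id_gaussianReal 2
  exact (memLp_map_measure_iff aestronglyMeasurable_id hY.aemeasurable).1 h2

lemma integral_sq_of_map_eq_gaussianReal {P : Measure Ω} {Y : Ω → ℝ} (hY : Measurable Y)
    {v : NNReal} (h : P.map Y = gaussianReal 0 v) : ∫ ω, Y ω ^ 2 ∂P = v := by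
  have hvar := variance_fun_id_gaussianReal (μ := 0) (v := v)
  rw [variance_eq_integral (by fun_prop), integral_id_gaussianReal, ← h,
    integral_map hY.aemeasurable (by fun_prop)] at hvar
  simpa using hvar

namespace IsFBM

variable {P : Measure Ω} {H : ℝ} {W : ℝ → Ω → ℝ}

lemma measurable (hW : IsFBM P H W) (t : ℝ) : Measurable (W t) :=
  hW.jointMeasurable.comp measurable_prodMk_left

lemma measurable_nifBmSum (hW : IsFBM P H W) (h t : ℝ) (N : ℕ) :
    Measurable (nifBmSum W h t N) :=
  Finset.measurable_sum _ fun _ _ => (hW.measurable _).const_mul _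

lemma aemeasurable_nifBm (hW : IsFBM P H W) {h : ℝ} (hh : h ≠ 0) (t : ℝ) :
    AEMeasurable (nifBm W h t) P :=
  aemeasurable_of_tendsto_metrizable_ae atTop
    (fun N => (hW.measurable_nifBmSum h t N).aemeasurable)
    (hW.cont.mono fun _ hω => tendsto_nifBmSum hω hh t)

lemma exists_map_sum_eq_gaussianReal (hW : IsFBM P H W) {ι : Type*} [Fintype ι] {s : ι → ℝ}
    (hs : ∀ i, 0 ≤ s i) (a : ι → ℝ) :
    ∃ v : NNReal, P.map (fun ω => ∑ i, a i * W (s i) ω) = gaussianReal 0 v := by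
  let e := (Fintype.equivFin ι).symm
  obtain ⟨v, hv⟩ := hW.gaussian_fdd _ (s ∘ e) (fun _ => hs _) (a ∘ e)
  refine ⟨v, ?_⟩
  rw [← hv]
  congr 1
  ext ω
  exact (e.sum_comp fun i => a i * W (s i) ω).symm

lemma memLp_two_s5 (hW : IsFBM P H W) {t : ℝ} (ht : 0 ≤ t) : MemLp (W t) 2 P := by
  obtain ⟨v, hv⟩ := hW.exists_map_sum_eq_gaussianReal (ι := Unit) (fun _ => ht) fun _ => 1
  exact memLp_two_of_map_eq_gaussianReal (hW.measurable t) (by simpa using hv)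

lemma integral_sum_sq (hW : IsFBM P H W) {ι : Type*} [Fintype ι] {s : ι → ℝ}
    (hs : ∀ i, 0 ≤ s i) (a : ι → ℝ) :
    ∫ ω, (∑ i, a i * W (s i) ω) ^ 2 ∂P = ∑ i, ∑ j, a i * a j *
      ((s i ^ (2 * H) + s j ^ (2 * H) - |s i - s j| ^ (2 * H)) / 2) := by
  have hint : ∀ i j, Integrable (fun ω => a i * a j * (W (s i) ω * W (s j) ω)) P := fun i j =>
    ((hW.memLp_two_s5 (hs i)).integrable_mul (hW.memLp_two_s5 (hs j))).const_mul _
  have hsq : ∀ ω, (∑ i, a i * W (s i) ω) ^ 2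
      = ∑ i, ∑ j, a i * a j * (W (s i) ω * W (s j) ω) := fun ω => by
    rw [sq, Finset.sum_mul_sum]
    exact Finset.sum_congr rfl fun i _ => Finset.sum_congr rfl fun j _ => by ring
  simp_rw [hsq]
  rw [integral_finsetSum _ fun i _ => integrable_finsetSum _ fun j _ => hint i j]
  refine Finset.sum_congr rfl fun i _ => ?_
  rw [integral_finsetSum _ fun j _ => hint i j]
  refine Finset.sum_congr rfl fun j _ => ?_
  rw [integral_const_mul, hW.cov _ _ (hs i) (hs j)]

/-- Self-similarity of fractional Brownian motion, for finite linear combinations. -/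
lemma map_sum_const_mul (hW : IsFBM P H W) {c : ℝ} (hc : 0 < c) {ι : Type*} [Fintype ι]
    {s : ι → ℝ} (hs : ∀ i, 0 ≤ s i) (a : ι → ℝ) :
    P.map (fun ω => ∑ i, a i * W (c * s i) ω)
      = P.map (fun ω => c ^ H * ∑ i, a i * W (s i) ω) := by
  have hcs : ∀ i, 0 ≤ c * s i := fun i => mul_nonneg hc.le (hs i)
  have hmul : ∀ ω, c ^ H * ∑ i, a i * W (s i) ω = ∑ i, c ^ H * a i * W (s i) ω := fun ω => by
    simp_rw [Finset.mul_sum, mul_assoc]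
  simp_rw [hmul]
  obtain ⟨v, hv⟩ := hW.exists_map_sum_eq_gaussianReal hcs a
  obtain ⟨w, hw⟩ := hW.exists_map_sum_eq_gaussianReal hs fun i => c ^ H * a i
  have hmeas : ∀ (r b : ι → ℝ), Measurable fun ω => ∑ i, b i * W (r i) ω := fun r b =>
    Finset.measurable_sum _ fun _ _ => (hW.measurable _).const_mul _
  have hv2 := integral_sq_of_map_eq_gaussianReal (hmeas _ _) hv
  have hw2 := integral_sq_of_map_eq_gaussianReal (hmeas _ _) hw
  rw [hW.integral_sum_sq hcs] at hv2
  rw [hW.integral_sum_sq hs] at hw2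
  have hpow : c ^ (2 * H) = c ^ H * c ^ H := by rw [two_mul, Real.rpow_add hc]
  have hvw : v = w := by
    rw [← NNReal.coe_inj, ← hv2, ← hw2]
    refine Finset.sum_congr rfl fun i _ => Finset.sum_congr rfl fun j _ => ?_
    rw [← mul_sub, abs_mul, abs_of_pos hc, Real.mul_rpow hc.le (hs i), Real.mul_rpow hc.le (hs j),
      Real.mul_rpow hc.le (abs_nonneg _), hpow]
    ring
  rw [hv, hw, hvw]

lemma map_sum_nifBmSum (hW : IsFBM P H W) {h c : ℝ} (hh : 0 < h) (hc : 0 < c)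
    {ι : Type*} [Fintype ι] {t : ι → ℝ} (ht : ∀ i, 0 ≤ t i) (a : ι → ℝ) (N : ℕ) :
    P.map (fun ω => ∑ i, a i * nifBmSum W (c * h) (c * t i) N ω)
      = P.map (fun ω => ∑ i, a i * (c ^ H * nifBmSum W h (t i) N ω)) := by
  have key := hW.map_sum_const_mul hc (ι := ι × Fin N) (s := fun p => t p.1 + h * (p.2 / N))
    (fun p => add_nonneg (ht _) (by positivity)) fun p => a p.1 * (N : ℝ)⁻¹
  convert key using 3 with ω ω
  · simp_rw [Fintype.sum_prod_type, nifBmSum, Finset.mul_sum, mul_add, mul_assoc]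
  · simp_rw [Fintype.sum_prod_type, nifBmSum, Finset.mul_sum]
    exact Finset.sum_congr rfl fun i _ => Finset.sum_congr rfl fun k _ => by ring

end IsFBM

/-- Two a.e. limits of random vectors have the same law as soon as the linear combinations of the
coordinates of the approximating vectors have pairwise the same law. -/
lemma map_eq_of_tendsto_of_map_sum_eq {P : Measure Ω} [IsProbabilityMeasure P]
    {ι : Type*} [Fintype ι] {X Y : ι → Ω → ℝ} {XN YN : ℕ → ι → Ω → ℝ}
    (hXN : ∀ N i, AEMeasurable (XN N i) P) (hYN : ∀ N i, AEMeasurable (YN N i) P)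
    (hX : ∀ᵐ ω ∂P, ∀ i, Tendsto (fun N => XN N i ω) atTop (𝓝 (X i ω)))
    (hY : ∀ᵐ ω ∂P, ∀ i, Tendsto (fun N => YN N i ω) atTop (𝓝 (Y i ω)))
    (h : ∀ (a : ι → ℝ) (N : ℕ),
      P.map (fun ω => ∑ i, a i * XN N i ω) = P.map (fun ω => ∑ i, a i * YN N i ω)) :
    P.map (fun ω i => X i ω) = P.map (fun ω i => Y i ω) := by
  classical
  have hlim : ∀ {Z : ι → Ω → ℝ} {ZN : ℕ → ι → Ω → ℝ}, (∀ N i, AEMeasurable (ZN N i) P) →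
      (∀ᵐ ω ∂P, ∀ i, Tendsto (fun N => ZN N i ω) atTop (𝓝 (Z i ω))) →
      AEMeasurable (fun ω i => Z i ω) P ∧ ∀ L : StrongDual ℝ (ι → ℝ),
        Tendsto (fun N => charFun (P.map fun ω => ∑ i, L (Pi.single i 1) * ZN N i ω) 1) atTop
          (𝓝 (charFunDual (P.map fun ω i => Z i ω) L)) := by
    intro Z ZN hZN hZ
    have hZm : AEMeasurable (fun ω i => Z i ω) P := aemeasurable_pi_iff.2 fun i =>
      aemeasurable_of_tendsto_metrizable_ae atTop (fun N => hZN N i) (hZ.mono fun _ hω => hω i)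
    refine ⟨hZm, fun L => ?_⟩
    have hsum : ∀ N, AEMeasurable (fun ω => ∑ i, L (Pi.single i 1) * ZN N i ω) P := fun N =>
      Finset.aemeasurable_fun_sum _ fun i _ => (hZN N i).const_mul _
    have hL : ∀ z : ι → ℝ, L z = ∑ i, L (Pi.single i 1) * z i := fun z => by
      conv_lhs => rw [pi_eq_sum_univ' z, map_sum]
      exact Finset.sum_congr rfl fun i _ => by rw [map_smul, smul_eq_mul, mul_comm]
    rw [charFunDual_apply, integral_map hZm (by fun_prop)]
    simp_rw [charFun_apply_real]
    have hmap : ∀ N, ∫ x, Complex.exp ((1 : ℝ) * x * Complex.I)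
          ∂(P.map fun ω => ∑ i, L (Pi.single i 1) * ZN N i ω)
        = ∫ ω, Complex.exp ((∑ i, L (Pi.single i 1) * ZN N i ω : ℝ) * Complex.I) ∂P := fun N => by
      rw [integral_map (hsum N) (by fun_prop)]
      simp
    simp_rw [hmap]
    refine tendsto_integral_of_dominated_convergence (fun _ => 1) (fun N => ?_)
      (integrable_const _) (fun N => ae_of_all _ fun ω => ?_) (hZ.mono fun ω hω => ?_)
    · exact (Continuous.comp_aestronglyMeasurable (g := fun x : ℝ => Complex.exp (x * Complex.I))
        (by fun_prop) (hsum N).aestronglyMeasurable)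
    · rw [Complex.norm_exp_ofReal_mul_I]
    · rw [hL]
      have hg : Continuous fun x : ℝ => Complex.exp (x * Complex.I) := by fun_prop
      exact (hg.tendsto _).comp (tendsto_finsetSum _ fun i _ => (hω i).const_mul _)
  obtain ⟨hXm, hX'⟩ := hlim hXN hX
  obtain ⟨hYm, hY'⟩ := hlim hYN hY
  have := Measure.isProbabilityMeasure_map hXm
  have := Measure.isProbabilityMeasure_map hYm
  refine Measure.ext_of_charFunDual (funext fun L => tendsto_nhds_unique (hX' L) ?_)
  simp_rw [h]
  exact hY' L

/-- Self-similarity of the nifBm: for every `c > 0`, the processes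
`{X_{ct}^{ch,H}}` and `{c^H X_t^{h,H}}` have the same finite-dimensional distributions. -/
theorem nifBm_self_similar
    (P : Measure Ω) [IsProbabilityMeasure P] (H : ℝ) (hH : H ∈ Set.Ioo (0:ℝ) 1)
    (W : ℝ → Ω → ℝ) (hW : IsFBM P H W) (h c : ℝ) (hh : 0 < h) (hc : 0 < c)
    (n : ℕ) (t : Fin n → ℝ) (ht : ∀ i, 0 ≤ t i) :
    P.map (fun ω i => nifBm W (c*h) (c * t i) ω)
      = P.map (fun ω i => c ^ H * nifBm W h (t i) ω) := by
  have hch : c * h ≠ 0 := (mul_pos hc hh).ne'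
  refine map_eq_of_tendsto_of_map_sum_eq
    (X := fun i => nifBm W (c * h) (c * t i)) (Y := fun i ω => c ^ H * nifBm W h (t i) ω)
    (XN := fun N i => nifBmSum W (c * h) (c * t i) N)
    (YN := fun N i ω => c ^ H * nifBmSum W h (t i) N ω)
    (fun N i => (hW.measurable_nifBmSum _ _ N).aemeasurable)
    (fun N i => ((hW.measurable_nifBmSum _ _ N).const_mul _).aemeasurable)
    (hW.cont.mono fun ω hω i => tendsto_nifBmSum hω hch _)
    (hW.cont.mono fun ω hω i => (tendsto_nifBmSum hω hh.ne' _).const_mul _)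
    fun a N => hW.map_sum_nifBmSum hh hc ht a N
end
end
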